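/- arXiv:2202.06896 — 11 statements merged into one kernel-verified Lean document; each statement's English description precedes it below -/
import Mathlib

section
/- Let n ≥ 1 and let H : ℝⁿ × ℝⁿ → ℝ be smooth. Let γ : ℝⁿ → ℝⁿ be a closed one-form, i.e. ∂γᵢ/∂qʲ = ∂γⱼ/∂qⁱ for all i, j. Then the following are equivalent: (i) X_H^γ and X_H are γ-related, i.e. for every q ∈ ℝⁿ the derivative of Γ(q) = (q, γ(q)) sends X_H^γ(q) to X_H(Γ(q)) (equivalently, Σᵢ (∂γⱼ/∂qⁱ)(q)·(∂H/∂pᵢ)(q,γ(q)) = −(∂H/∂qʲ)(q,γ(q)) for all j, q); (ii) the function q ↦ H(q, γ(q)) has identically vanishing derivative on ℝⁿ (hence is constant). -/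
/-- Chain rule for a function restricted to the graph of `γ`, in coordinates. -/
theorem fderiv_comp_graph_single {n : ℕ}
    {H : (Fin n → ℝ) × (Fin n → ℝ) → ℝ} {γ : (Fin n → ℝ) → (Fin n → ℝ)} {q : Fin n → ℝ}
    (hH : DifferentiableAt ℝ H (q, γ q)) (hγ : DifferentiableAt ℝ γ q) (j : Fin n) :
    fderiv ℝ (fun q' => H (q', γ q')) q (Pi.single j 1) =
      fderiv ℝ H (q, γ q) (Pi.single j 1, (0 : Fin n → ℝ)) +
        ∑ i, fderiv ℝ (fun q' => γ q' i) q (Pi.single j 1) *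
          fderiv ℝ H (q, γ q) ((0 : Fin n → ℝ), Pi.single i 1) := by
  have hchain : HasFDerivAt (fun q' => H (q', γ q'))
      ((fderiv ℝ H (q, γ q)).comp ((ContinuousLinearMap.id ℝ _).prod (fderiv ℝ γ q))) q :=
    hH.hasFDerivAt.comp q ((hasFDerivAt_id q).prodMk hγ.hasFDerivAt)
  have hcoord (i : Fin n) (v : Fin n → ℝ) :
      fderiv ℝ (fun q' => γ q' i) q v = fderiv ℝ γ q v i := by
    rw [fderiv_apply hγ i]
    rfl
  have hsplit (v w : Fin n → ℝ) : fderiv ℝ H (q, γ q) (v, w) =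
      fderiv ℝ H (q, γ q) (v, 0) +
        ∑ i, w i * fderiv ℝ H (q, γ q) ((0 : Fin n → ℝ), Pi.single i 1) := by
    have hw : w = ∑ i, w i • Pi.single i (1 : ℝ) := pi_eq_sum_univ' w
    rw [← Prod.fst_add_snd (v, w), map_add]
    congr 1
    change ((fderiv ℝ H (q, γ q)).comp (.inr ℝ _ _)) w = _
    conv_lhs => rw [hw]
    simp
  rw [hchain.fderiv]
  simp only [hcoord]
  exact hsplit _ _

/-- **Geometric Hamilton–Jacobi theorem, time-independent case.**
If `γ` is a closed one-form on `ℝⁿ`, then the projected vector field `X_H^γ` and the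
Hamiltonian vector field `X_H` are `γ`-related (coordinate form:
`Σᵢ ∂γⱼ/∂qⁱ ∂H/∂pᵢ = −∂H/∂qʲ` along the image of `γ`) if and only if the function
`q ↦ H(q, γ(q))` has identically vanishing derivative. -/
theorem stmt_0 (n : ℕ) (hn : 1 ≤ n)
    (H : (Fin n → ℝ) × (Fin n → ℝ) → ℝ) (hH : ContDiff ℝ (⊤ : ℕ∞) H)
    (γ : (Fin n → ℝ) → (Fin n → ℝ)) (hγ : ContDiff ℝ (⊤ : ℕ∞) γ)
    (hclosed : ∀ (i j : Fin n) (q : Fin n → ℝ),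
      fderiv ℝ (fun q' => γ q' i) q (Pi.single j 1) =
        fderiv ℝ (fun q' => γ q' j) q (Pi.single i 1)) :
    (∀ (j : Fin n) (q : Fin n → ℝ),
        ∑ i, fderiv ℝ (fun q' => γ q' j) q (Pi.single i 1) *
            fderiv ℝ H (q, γ q) ((0 : Fin n → ℝ), Pi.single i 1) =
          - fderiv ℝ H (q, γ q) (Pi.single j 1, (0 : Fin n → ℝ))) ↔
    (∀ q : Fin n → ℝ, fderiv ℝ (fun q' => H (q', γ q')) q = 0) := by
  have hrelated (j : Fin n) (q : Fin n → ℝ) :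
      ∑ i, fderiv ℝ (fun q' => γ q' j) q (Pi.single i 1) *
            fderiv ℝ H (q, γ q) ((0 : Fin n → ℝ), Pi.single i 1) =
          - fderiv ℝ H (q, γ q) (Pi.single j 1, (0 : Fin n → ℝ)) ↔
        fderiv ℝ (fun q' => H (q', γ q')) q (Pi.single j 1) = 0 := by
    rw [fderiv_comp_graph_single (hH.differentiable (by simp) (q, γ q))
      (hγ.differentiable (by simp) q) j, add_comm, add_eq_zero_iff_eq_neg]
    simp only [hclosed j]
  simp only [hrelated]
  refine ⟨fun h q => ?_, fun h j q => by simp [h q]⟩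
  apply ContinuousLinearMap.coe_injective
  refine LinearMap.pi_ext' fun j => LinearMap.ext_ring ?_
  simpa using h j q
end

section
/- Let n ≥ 1, H : ℝⁿ × ℝⁿ → ℝ smooth, and γ : ℝⁿ → ℝⁿ a solution of the geometric Hamilton–Jacobi problem: γ is closed (∂γᵢ/∂qʲ = ∂γⱼ/∂qⁱ for all i, j) and the function q ↦ H(q, γ(q)) is constant. If c : I → ℝⁿ is a C¹ curve on an interval I satisfying (cⁱ)′(t) = (∂H/∂pᵢ)(c(t), γ(c(t))) for all i and t ∈ I, then the curve t ↦ (c(t), γ(c(t))) satisfies Hamilton's equations: (cⁱ)′(t) = (∂H/∂pᵢ)(c(t), γ(c(t))) and (γᵢ ∘ c)′(t) = −(∂H/∂qⁱ)(c(t), γ(c(t))) for all i and t ∈ I. -/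
theorem ContinuousLinearMap.apply_eq_sum_mul_apply_single {ι : Type*} [Fintype ι] [DecidableEq ι]
    (f : (ι → ℝ) →L[ℝ] ℝ) (v : ι → ℝ) : f v = ∑ j, v j * f (Pi.single j 1) := by
  conv_lhs => rw [pi_eq_sum_univ' v]
  simp only [map_sum, map_smul, smul_eq_mul]

/-- Differentiating the Hamilton–Jacobi equation: the differential of `H` vanishes on vectors
tangent to the graph of `γ`. -/
theorem fderiv_apply_graph_eq_zero {E F : Type*} [NormedAddCommGroup E] [NormedSpace ℝ E]
    [NormedAddCommGroup F] [NormedSpace ℝ F] {H : E × F → ℝ} {γ : E → F} {q : E}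
    (hH : DifferentiableAt ℝ H (q, γ q)) (hγ : DifferentiableAt ℝ γ q)
    (hHJ : ∀ q q' : E, H (q, γ q) = H (q', γ q')) (v : E) :
    fderiv ℝ H (q, γ q) (v, fderiv ℝ γ q v) = 0 := by
  have hcomp : HasFDerivAt (fun x => H (x, γ x)) _ q :=
    HasFDerivAt.comp (f := fun x => (x, γ x)) q hH.hasFDerivAt
      ((hasFDerivAt_id q).prodMk hγ.hasFDerivAt)
  have hconst : HasFDerivAt (fun x => H (x, γ x)) (0 : E →L[ℝ] ℝ) q := by
    rw [funext fun x => hHJ x q]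
    exact hasFDerivAt_const _ _
  simpa using DFunLike.congr_fun (hcomp.unique hconst) v

/-- If `γ` is a solution of the geometric Hamilton–Jacobi problem (closed, with
`H ∘ (id, γ)` constant), then any integral curve `c` of the projected vector field
`X_H^γ` gives rise to the horizontal curve `t ↦ (c(t), γ(c(t)))` satisfying
Hamilton's equations for `H`. -/
theorem stmt_1 (n : ℕ) (hn : 1 ≤ n)
    (H : (Fin n → ℝ) × (Fin n → ℝ) → ℝ) (hH : ContDiff ℝ (⊤ : ℕ∞) H)
    (γ : (Fin n → ℝ) → (Fin n → ℝ)) (hγ : ContDiff ℝ (⊤ : ℕ∞) γ)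
    (hclosed : ∀ (i j : Fin n) (q : Fin n → ℝ),
      fderiv ℝ (fun q' => γ q' i) q (Pi.single j 1) =
        fderiv ℝ (fun q' => γ q' j) q (Pi.single i 1))
    (hHJ : ∀ q q' : Fin n → ℝ, H (q, γ q) = H (q', γ q'))
    (I : Set ℝ) (c : ℝ → (Fin n → ℝ))
    (hc : ∀ (i : Fin n), ∀ t ∈ I, HasDerivAt (fun s => c s i)
        (fderiv ℝ H (c t, γ (c t)) ((0 : Fin n → ℝ), Pi.single i 1)) t) :
    ∀ (i : Fin n), ∀ t ∈ I,
      HasDerivAt (fun s => c s i)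
        (fderiv ℝ H (c t, γ (c t)) ((0 : Fin n → ℝ), Pi.single i 1)) t ∧
      HasDerivAt (fun s => γ (c s) i)
        (- fderiv ℝ H (c t, γ (c t)) (Pi.single i 1, (0 : Fin n → ℝ))) t := by
  intro i t ht
  refine ⟨hc i t ht, ?_⟩
  have hγd : DifferentiableAt ℝ γ (c t) := hγ.differentiable (by simp) _
  have hHd : DifferentiableAt ℝ H (c t, γ (c t)) := hH.differentiable (by simp) _
  have hcd : HasDerivAt c (fun j => fderiv ℝ H (c t, γ (c t)) (0, Pi.single j 1)) t :=
    hasDerivAt_pi.2 fun j => hc j t ht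
  have hγi (j : Fin n) : DifferentiableAt ℝ (fun q => γ q j) (c t) := differentiableAt_pi.1 hγd j
  refine ((hγi i).hasFDerivAt.comp_hasDerivAt t hcd).congr_deriv ?_
  rw [ContinuousLinearMap.apply_eq_sum_mul_apply_single]
  have hgraph := fderiv_apply_graph_eq_zero hHd hγd hHJ (Pi.single i 1)
  set L := fderiv ℝ H (c t, γ (c t))
  have hfiber := ContinuousLinearMap.apply_eq_sum_mul_apply_single
    (L.comp (ContinuousLinearMap.inr ℝ (Fin n → ℝ) (Fin n → ℝ)))
    (fderiv ℝ γ (c t) (Pi.single i 1))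
  simp only [ContinuousLinearMap.comp_apply, ContinuousLinearMap.inr_apply] at hfiber
  have hsplit (v w : Fin n → ℝ) : L (v, w) = L (v, 0) + L (0, w) := by
    rw [← map_add]; simp
  rw [hsplit, hfiber] at hgraph
  rw [neg_eq_of_add_eq_zero_right hgraph]
  refine Finset.sum_congr rfl fun j _ => ?_
  rw [hclosed i j, fderiv_apply hγd, mul_comm]
  rfl
end

section
/- Let n ≥ 1, H : ℝⁿ × ℝⁿ → ℝ smooth, and g : ℝⁿ × ℝⁿ → ℝⁿ smooth (written g(q, λ)) such that: (a) the map S : ℝⁿ × ℝⁿ → ℝⁿ × ℝⁿ, S(q, λ) = (q, g(q, λ)), is a bijection with smooth inverse; (b) for each fixed λ, the map q ↦ g(q, λ) is closed, i.e. ∂gᵢ/∂qʲ = ∂gⱼ/∂qⁱ for all i, j; (c) for each fixed λ, the function q ↦ H(q, g(q, λ)) is constant (each S_λ is a solution of the Hamilton–Jacobi problem). Define F : ℝⁿ × ℝⁿ → ℝⁿ by F = pr₂ ∘ S⁻¹ (so F(S(q, λ)) = λ). Then the components of F pairwise commute under the canonical Poisson bracket: for all i, j and all (q, p), Σₖ [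 (∂Fᵢ/∂qᵏ)(∂Fⱼ/∂pₖ) − (∂Fᵢ/∂pₖ)(∂Fⱼ/∂qᵏ) ](q,p) = 0. -/
/-- If `f` is constant along the graph of `γ`, then the derivative of `f` in the base direction
`k` is minus its derivative along the `k`-th partial derivative of `γ`. -/
theorem fderiv_single_eq_neg_sum {n : ℕ} {f : (Fin n → ℝ) × (Fin n → ℝ) → ℝ}
    {γ : (Fin n → ℝ) → Fin n → ℝ} {q : Fin n → ℝ} {c : ℝ}
    (hf : DifferentiableAt ℝ f (q, γ q)) (hγ : DifferentiableAt ℝ γ q)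
    (hc : ∀ q', f (q', γ q') = c) (k : Fin n) :
    fderiv ℝ f (q, γ q) (Pi.single k 1, 0) =
      -∑ m, fderiv ℝ f (q, γ q) (0, Pi.single m 1) *
        fderiv ℝ (fun q' => γ q' m) q (Pi.single k 1) := by
  have hcomp := hf.hasFDerivAt.comp q ((hasFDerivAt_id q).prodMk hγ.hasFDerivAt)
  have hzero : HasFDerivAt (f ∘ fun q' => (id q', γ q')) (0 : (Fin n → ℝ) →L[ℝ] ℝ) q := by
    rw [show (f ∘ fun q' => (id q', γ q')) = fun _ => c from funext hc]
    exact hasFDerivAt_const c q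
  have h := DFunLike.congr_fun (hcomp.unique hzero) (Pi.single k 1)
  set v := fderiv ℝ γ q (Pi.single k 1)
  have hvm (m : Fin n) : fderiv ℝ (fun q' => γ q' m) q (Pi.single k 1) = v m := by
    rw [(hasFDerivAt_pi'.1 hγ.hasFDerivAt m).fderiv]
    rfl
  have hsplit : ((Pi.single k 1, v) : (Fin n → ℝ) × (Fin n → ℝ)) =
      (Pi.single k 1, 0) + ∑ m, v m • ((0 : Fin n → ℝ), (Pi.single m 1 : Fin n → ℝ)) := by
    ext m
    · simp [Prod.fst_sum]
    · simp [Prod.snd_sum, Finset.sum_apply, Pi.single_apply]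
  have h' : fderiv ℝ f (q, γ q) (Pi.single k 1, v) = 0 := h
  rw [hsplit, map_add, map_sum] at h'
  simp only [map_smul, smul_eq_mul] at h'
  simp only [hvm, mul_comm _ (v _)]
  exact eq_neg_of_add_eq_zero_left h'


/-- **Complete solutions of the Hamilton–Jacobi problem.**
If `S(q, λ) = (q, g(q, λ))` is a complete solution of the Hamilton–Jacobi problem
(a bijection with smooth inverse such that each `q ↦ g(q, λ)` is closed and
`q ↦ H(q, g(q, λ))` is constant), then the components of `F = pr₂ ∘ S⁻¹` pairwise
commute under the canonical Poisson bracket. -/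
theorem stmt_2 (n : ℕ) (hn : 1 ≤ n)
    (H : (Fin n → ℝ) × (Fin n → ℝ) → ℝ) (hH : ContDiff ℝ (⊤ : ℕ∞) H)
    (g : (Fin n → ℝ) → (Fin n → ℝ) → (Fin n → ℝ))
    (hg : ContDiff ℝ (⊤ : ℕ∞) (fun x : (Fin n → ℝ) × (Fin n → ℝ) => g x.1 x.2))
    (Sinv : (Fin n → ℝ) × (Fin n → ℝ) → (Fin n → ℝ) × (Fin n → ℝ))
    (hSinv : ContDiff ℝ (⊤ : ℕ∞) Sinv)
    (hleft : Function.LeftInverse Sinv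
      (fun x : (Fin n → ℝ) × (Fin n → ℝ) => (x.1, g x.1 x.2)))
    (hright : Function.RightInverse Sinv
      (fun x : (Fin n → ℝ) × (Fin n → ℝ) => (x.1, g x.1 x.2)))
    (hclosed : ∀ (lam : Fin n → ℝ) (i j : Fin n) (q : Fin n → ℝ),
      fderiv ℝ (fun q' => g q' lam i) q (Pi.single j 1) =
        fderiv ℝ (fun q' => g q' lam j) q (Pi.single i 1))
    (hconst : ∀ (lam : Fin n → ℝ) (q q' : Fin n → ℝ), H (q, g q lam) = H (q', g q' lam)) :
    ∀ (i j : Fin n) (w : (Fin n → ℝ) × (Fin n → ℝ)),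
      ∑ k, (fderiv ℝ (fun w' => (Sinv w').2 i) w (Pi.single k 1, (0 : Fin n → ℝ)) *
              fderiv ℝ (fun w' => (Sinv w').2 j) w ((0 : Fin n → ℝ), Pi.single k 1) -
            fderiv ℝ (fun w' => (Sinv w').2 i) w ((0 : Fin n → ℝ), Pi.single k 1) *
              fderiv ℝ (fun w' => (Sinv w').2 j) w (Pi.single k 1, (0 : Fin n → ℝ))) = 0 := by
  intro i j w
  obtain ⟨⟨q, lam⟩, rfl⟩ : ∃ x : (Fin n → ℝ) × (Fin n → ℝ), (x.1, g x.1 x.2) = w :=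
    ⟨Sinv w, hright w⟩
  have hgd : DifferentiableAt ℝ (fun q' => g q' lam) q :=
    DifferentiableAt.fun_comp' (f := fun q' => (q', lam)) q
      ((hg.differentiable (by simp)) (q, lam)) (by fun_prop)
  have hFd (i : Fin n) : DifferentiableAt ℝ (fun w' => (Sinv w').2 i) (q, g q lam) := by
    have := (hSinv.differentiable (by simp)) (q, g q lam)
    fun_prop
  have key (i k : Fin n) := fderiv_single_eq_neg_sum (hFd i) hgd
    (fun q' => congrFun (congrArg Prod.snd (hleft (q', lam))) i) k
  simp only [key, neg_mul, mul_neg, Finset.sum_mul, Finset.mul_sum, sub_neg_eq_add,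
    Finset.sum_add_distrib, Finset.sum_neg_distrib]
  rw [Finset.sum_comm, neg_add_eq_zero]
  refine Finset.sum_congr rfl fun k _ => Finset.sum_congr rfl fun m _ => ?_
  rw [hclosed lam k m q]
  ring
end

section
/- Let n ≥ 1 and H : ℝ × ℝⁿ × ℝⁿ → ℝ smooth (a time-dependent Hamiltonian H(t, q, p)). Let γ = (γ₀, γ₁, …, γₙ) : ℝ × ℝⁿ → ℝ × ℝⁿ be a closed one-form on ℝ × ℝⁿ, i.e. its full Jacobian is symmetric: ∂γ₀/∂qʲ = ∂γⱼ/∂t and ∂γᵢ/∂qʲ = ∂γⱼ/∂qⁱ for all i, j. Then the following are equivalent: (i) for all (t, q) and all j, (∂γⱼ/∂t)(t,q) + Σᵢ (∂H/∂pᵢ)(t, q, γ₍q₎(t,q)) · (∂γⱼ/∂qⁱ)(t,q) = −(∂H/∂qʲ)(t, q, γ₍q₎(t,q)), where γ₍q₎ = (γ₁, …, γₙ) (i.e. the projected vector field and the vector field ∂/∂t + X_H are related by the map (t,q) ↦ (t, q, γ₍q₎(t,q))); (ii) for all (t, q) and all j, ∂/∂qʲ [ H(t, q, γ₍q₎(t,q))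 + γ₀(t,q) ] = 0 (i.e. d(H^e ∘ γ) lies in the span of dt, where H^e = H + e is the extended Hamiltonian). -/
/-- A continuous linear functional on `E × F × (ι → ℝ)` in terms of its values on the
coordinate vectors of the last factor. -/
theorem ContinuousLinearMap.apply_prodMk_prodMk_pi {E F ι : Type*} [Fintype ι] [DecidableEq ι]
    [NormedAddCommGroup E] [NormedSpace ℝ E] [NormedAddCommGroup F] [NormedSpace ℝ F]
    (L : E × F × (ι → ℝ) →L[ℝ] ℝ) (a : E) (b : F) (v : ι → ℝ) :
    L (a, b, v) = L (a, b, 0) + ∑ i, L (0, 0, Pi.single i 1) * v i := by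
  have hv : (a, b, v) = (a, b, (0 : ι → ℝ)) +
      ∑ i, v i • ((0 : E), (0 : F), (Pi.single i 1 : ι → ℝ)) := by
    refine Prod.ext ?_ (Prod.ext ?_ ?_)
    · simp [Prod.fst_sum]
    · simp [Prod.fst_sum, Prod.snd_sum]
    · simpa [Prod.snd_sum] using pi_eq_sum_univ' v
  simp only [hv, map_add, map_sum, map_smul, smul_eq_mul, mul_comm]

/-- The chain rule for a function `H` of `(t, q, p)` restricted to the graph of `p = g (t, q)`. -/
theorem fderiv_comp_graph_apply {E F ι : Type*} [Fintype ι] [DecidableEq ι]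
    [NormedAddCommGroup E] [NormedSpace ℝ E] [NormedAddCommGroup F] [NormedSpace ℝ F]
    {H : E × F × (ι → ℝ) → ℝ} {g : E × F → ι → ℝ} {x : E × F}
    (hH : DifferentiableAt ℝ H (x.1, x.2, g x)) (hg : DifferentiableAt ℝ g x) (w : E × F) :
    fderiv ℝ (fun y : E × F => H (y.1, y.2, g y)) x w =
      fderiv ℝ H (x.1, x.2, g x) (w.1, w.2, 0) +
        ∑ i, fderiv ℝ H (x.1, x.2, g x) (0, 0, Pi.single i 1) *
          fderiv ℝ (fun y => g y i) x w := by
  have h : HasFDerivAt (fun y : E × F => H (y.1, y.2, g y)) _ x :=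
    hH.hasFDerivAt.comp x
      (hasFDerivAt_fst.prodMk (hasFDerivAt_snd.prodMk hg.hasFDerivAt))
  rw [h.fderiv]
  have hcoord (i : ι) : fderiv ℝ (fun y => g y i) x w = fderiv ℝ g x w i := by
    rw [(hasFDerivAt_pi'.1 hg.hasFDerivAt i).fderiv]
    rfl
  simp only [hcoord]
  exact (fderiv ℝ H (x.1, x.2, g x)).apply_prodMk_prodMk_pi w.1 w.2 _

/-- **Geometric Hamilton–Jacobi theorem, time-dependent case.**
For a time-dependent Hamiltonian `H(t,q,p)` and a closed one-form
`γ = (γ₀, γ₁, …, γₙ)` on `ℝ × ℝⁿ`, the projected vector field is related via `γ`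
to `∂/∂t + X_H` if and only if `d(H^e ∘ γ)` lies in the span of `dt`, i.e. all
`q`-partials of `H(t,q,γ₍q₎(t,q)) + γ₀(t,q)` vanish. -/
theorem stmt_3 (n : ℕ) (hn : 1 ≤ n)
    (H : ℝ × (Fin n → ℝ) × (Fin n → ℝ) → ℝ) (hH : ContDiff ℝ (⊤ : ℕ∞) H)
    (γ0 : ℝ × (Fin n → ℝ) → ℝ) (γv : ℝ × (Fin n → ℝ) → (Fin n → ℝ))
    (hγ0 : ContDiff ℝ (⊤ : ℕ∞) γ0) (hγv : ContDiff ℝ (⊤ : ℕ∞) γv)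
    (hclosed0 : ∀ (j : Fin n) (x : ℝ × (Fin n → ℝ)),
      fderiv ℝ γ0 x ((0 : ℝ), Pi.single j 1) =
        fderiv ℝ (fun x' => γv x' j) x ((1 : ℝ), (0 : Fin n → ℝ)))
    (hclosed : ∀ (i j : Fin n) (x : ℝ × (Fin n → ℝ)),
      fderiv ℝ (fun x' => γv x' i) x ((0 : ℝ), Pi.single j 1) =
        fderiv ℝ (fun x' => γv x' j) x ((0 : ℝ), Pi.single i 1)) :
    (∀ (j : Fin n) (x : ℝ × (Fin n → ℝ)),
        fderiv ℝ (fun x' => γv x' j) x ((1 : ℝ), (0 : Fin n → ℝ)) +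
        ∑ i, fderiv ℝ H (x.1, x.2, γv x)
              ((0 : ℝ), (0 : Fin n → ℝ), Pi.single i 1) *
            fderiv ℝ (fun x' => γv x' j) x ((0 : ℝ), Pi.single i 1) =
          - fderiv ℝ H (x.1, x.2, γv x) ((0 : ℝ), Pi.single j 1, (0 : Fin n → ℝ))) ↔
    (∀ (j : Fin n) (x : ℝ × (Fin n → ℝ)),
        fderiv ℝ (fun x' : ℝ × (Fin n → ℝ) => H (x'.1, x'.2, γv x') + γ0 x') x
          ((0 : ℝ), Pi.single j 1) = 0) := by
  have hHd : Differentiable ℝ H := hH.differentiable (by simp)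
  have hγ0d : Differentiable ℝ γ0 := hγ0.differentiable (by simp)
  have hγvd : Differentiable ℝ γv := hγv.differentiable (by simp)
  refine forall_congr' fun j => forall_congr' fun x => ?_
  have hcomp : DifferentiableAt ℝ
      (fun x' : ℝ × (Fin n → ℝ) => H (x'.1, x'.2, γv x')) x :=
    (hHd _).comp x (by fun_prop)
  rw [fderiv_fun_add hcomp (hγ0d x), add_apply,
    fderiv_comp_graph_apply (hHd _) (hγvd x), hclosed0 j x]
  simp only [hclosed _ j x]
  constructor <;> intro h <;> linarith
end

section
/- Let n ≥ 1 and H : ℝⁿ × ℝⁿ × ℝ → ℝ smooth (coordinates (q, p, t)). Define the Reeb vector field R_H on ℝⁿ × ℝⁿ × ℝ by R_H(q,p,t) = (∂H/∂pᵢ, −∂H/∂qⁱ, 1), the unique vector field with ι_{R_H}dt = 1 and ι_{R_H}Ω_H = 0 for Ω_H = dqⁱ∧dpᵢ + dH∧dt. Let γ : ℝⁿ × ℝ → ℝⁿ be a smooth map such that for each fixed t the map q ↦ γ(q,t) is closed (∂γⱼ/∂qⁱ = ∂γᵢ/∂qʲ for all i, j), and let R_H^γ(q,t) = ((∂H/∂pᵢ)(q,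 γ(q,t), t), 1) be the projection of R_H ∘ γ to ℝⁿ × ℝ. Then R_H and R_H^γ are γ-related (i.e. the derivative of (q,t) ↦ (q, γ(q,t), t) sends R_H^γ(q,t) to R_H(q, γ(q,t), t)) if and only if for all j, q, t: (∂γⱼ/∂t)(q,t) + Σᵢ (∂H/∂pᵢ)(q,γ(q,t),t)·(∂γⱼ/∂qⁱ)(q,t) + (∂H/∂qʲ)(q,γ(q,t),t) = 0 (the Hamilton–Jacobi equation on a cosymplectic manifold). -/
/-- A linear form on `ℝⁿ × ℝ` at `(v, 1)`, expanded in the standard basis. -/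
theorem ContinuousLinearMap.apply_prod_one_eq_add_sum {n : ℕ}
    (L : ((Fin n → ℝ) × ℝ) →L[ℝ] ℝ) (v : Fin n → ℝ) :
    L (v, 1) = L (0, 1) + ∑ i, v i * L (Pi.single i 1, 0) := by
  have h : (v, (1 : ℝ)) = (0, 1) + ∑ i, v i • ((Pi.single i 1 : Fin n → ℝ), (0 : ℝ)) := by
    ext k
    · simp [Prod.fst_sum, Finset.sum_apply, Pi.single_apply]
    · simp [Prod.snd_sum]
  rw [h, map_add, map_sum]
  simp only [map_smul, smul_eq_mul]

/-- The derivative of the section `(q, t) ↦ (q, γ(q, t), t)`. -/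
theorem fderiv_fst_prodMk_snd_apply {E F G : Type*}
    [NormedAddCommGroup E] [NormedSpace ℝ E] [NormedAddCommGroup F] [NormedSpace ℝ F]
    [NormedAddCommGroup G] [NormedSpace ℝ G] {γ : E × G → F} {x : E × G}
    (hγ : DifferentiableAt ℝ γ x) (v : E × G) :
    fderiv ℝ (fun y : E × G => (y.1, γ y, y.2)) x v = (v.1, fderiv ℝ γ x v, v.2) := by
  have h : HasFDerivAt (fun y : E × G => (y.1, γ y, y.2)) _ x :=
    hasFDerivAt_fst.prodMk (hγ.hasFDerivAt.prodMk hasFDerivAt_snd)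
  rw [h.fderiv]
  rfl

/-- **Hamilton–Jacobi theorem on a cosymplectic manifold.**
The Reeb field `R_H = (∂H/∂p, −∂H/∂q, 1)` of the cosymplectic structure
`(dt, Ω_H)` on `T*ℝⁿ × ℝ` and the projected field `R_H^γ = (∂H/∂p ∘ γ, 1)` are
`γ`-related iff `∂γⱼ/∂t + Σᵢ (∂H/∂pᵢ)(∂γⱼ/∂qⁱ) + ∂H/∂qʲ = 0` along `γ`. -/
theorem stmt_7 (n : ℕ) (hn : 1 ≤ n)
    (H : (Fin n → ℝ) × (Fin n → ℝ) × ℝ → ℝ) (hH : ContDiff ℝ (⊤ : ℕ∞) H)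
    (γ : (Fin n → ℝ) × ℝ → (Fin n → ℝ)) (hγ : ContDiff ℝ (⊤ : ℕ∞) γ)
    (hclosed : ∀ (i j : Fin n) (q : Fin n → ℝ) (t : ℝ),
      fderiv ℝ (fun q' => γ (q', t) i) q (Pi.single j 1) =
        fderiv ℝ (fun q' => γ (q', t) j) q (Pi.single i 1)) :
    (∀ x : (Fin n → ℝ) × ℝ,
        fderiv ℝ (fun y : (Fin n → ℝ) × ℝ =>
            ((y.1, γ y, y.2) : (Fin n → ℝ) × (Fin n → ℝ) × ℝ)) x
          ((fun i => fderiv ℝ H (x.1, γ x, x.2)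
              ((0 : Fin n → ℝ), Pi.single i 1, (0 : ℝ))), (1 : ℝ)) =
        ((fun i => fderiv ℝ H (x.1, γ x, x.2)
            ((0 : Fin n → ℝ), Pi.single i 1, (0 : ℝ))),
         (fun i => - fderiv ℝ H (x.1, γ x, x.2)
            (Pi.single i 1, (0 : Fin n → ℝ), (0 : ℝ))),
         (1 : ℝ))) ↔
    (∀ (j : Fin n) (x : (Fin n → ℝ) × ℝ),
        fderiv ℝ (fun y => γ y j) x ((0 : Fin n → ℝ), (1 : ℝ)) +
        ∑ i, fderiv ℝ H (x.1, γ x, x.2) ((0 : Fin n → ℝ), Pi.single i 1, (0 : ℝ)) *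
            fderiv ℝ (fun y => γ y j) x (Pi.single i 1, (0 : ℝ)) +
        fderiv ℝ H (x.1, γ x, x.2) (Pi.single j 1, (0 : Fin n → ℝ), (0 : ℝ)) = 0) := by
  have hd : Differentiable ℝ γ := hγ.differentiable (by simp)
  have hcomp : ∀ (j : Fin n) (x v : (Fin n → ℝ) × ℝ),
      fderiv ℝ γ x v j = fderiv ℝ (fun y => γ y j) x v := fun j x v => by
    rw [(hasFDerivAt_pi'.1 (hd x).hasFDerivAt j).fderiv]
    rfl
  rw [forall_comm]
  refine forall_congr' fun x => ?_
  rw [fderiv_fst_prodMk_snd_apply (hd x)]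
  simp only [Prod.mk.injEq, true_and, and_true, funext_iff, hcomp]
  refine forall_congr' fun j => ?_
  rw [ContinuousLinearMap.apply_prod_one_eq_add_sum, eq_neg_iff_add_eq_zero]
end

section
/- Let n ≥ 1, let ϑ : ℝⁿ → ℝⁿ be a closed one-form (∂ϑᵢ/∂qʲ = ∂ϑⱼ/∂qⁱ), and let H : ℝⁿ × ℝⁿ → ℝ be smooth. Define the LCS Hamiltonian vector field X_H on ℝⁿ × ℝⁿ (the unique vector field with ι_{X_H}Ω_θ = dH − Hθ, where Ω_θ = dqⁱ∧dpᵢ + θ∧Θ_Q) by its components: q̇ᵏ = ∂H/∂pₖ and ṗₖ = −∂H/∂qᵏ + H·ϑₖ + pₖ·Σᵢϑᵢ(∂H/∂pᵢ) − ϑₖ·Σⱼpⱼ(∂H/∂pⱼ). Let γ : ℝⁿ → ℝⁿ satisfy d_ϑγ = 0, i.e. (∂γₖ/∂qⁱ) − ϑᵢγₖ = (∂γᵢ/∂qᵏ) − ϑₖγᵢ for all i, k, and let X_H^γ(q) have components (∂H/∂pᵢ)(q, γ(q)). Then X_H and X_H^γ are γ-related (i.e. Dγ(q)(X_H^γ(q))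 equals the p-component of X_H(q, γ(q)) for all q) if and only if d_ϑ(H∘γ) = 0, i.e. ∂/∂qⁱ [H(q, γ(q))] = ϑᵢ(q)·H(q, γ(q)) for all i, q. -/
/-- A continuous linear map on `Fin n → ℝ` is determined by its values on the coordinate vectors. -/
theorem ContinuousLinearMap.apply_eq_sum_single {n : ℕ} {E : Type*} [NormedAddCommGroup E]
    [NormedSpace ℝ E] (L : (Fin n → ℝ) →L[ℝ] E) (v : Fin n → ℝ) :
    L v = ∑ i, v i • L (Pi.single i 1) := by
  conv_lhs => rw [pi_eq_sum_univ' v]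
  simp [map_sum]

/-- Chain rule for the restriction of a function to the graph of a map, in coordinates. -/
theorem fderiv_comp_graph_apply_s9 {n : ℕ} {E : Type*} [NormedAddCommGroup E] [NormedSpace ℝ E]
    {H : E × (Fin n → ℝ) → ℝ} {γ : E → Fin n → ℝ} {q : E}
    (hH : DifferentiableAt ℝ H (q, γ q)) (hγ : DifferentiableAt ℝ γ q) (w : E) :
    fderiv ℝ (fun q' => H (q', γ q')) q w =
      fderiv ℝ H (q, γ q) (w, 0) +
        ∑ i, fderiv ℝ γ q w i * fderiv ℝ H (q, γ q) (0, Pi.single i 1) := by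
  have h : HasFDerivAt (fun q' => H (q', γ q'))
      ((fderiv ℝ H (q, γ q)).comp ((ContinuousLinearMap.id ℝ E).prod (fderiv ℝ γ q))) q :=
    hH.hasFDerivAt.comp q ((hasFDerivAt_id q).prodMk hγ.hasFDerivAt)
  have hsum := ((fderiv ℝ H (q, γ q)).comp
    (ContinuousLinearMap.inr ℝ E (Fin n → ℝ))).apply_eq_sum_single (fderiv ℝ γ q w)
  simp only [ContinuousLinearMap.comp_apply, ContinuousLinearMap.inr_apply, smul_eq_mul] at hsum
  rw [h.fderiv, ← hsum, ← map_add]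
  simp

/-- **Hamilton–Jacobi theorem on a locally conformally symplectic manifold.**
For the LCS Hamiltonian vector field of `H` (w.r.t. `Ω_θ = dqⁱ∧dpᵢ + θ∧Θ_Q`,
`θ = ϑᵢ(q)dqⁱ` with `ϑ` closed) and a one-form `γ` with `d_ϑγ = 0`, the fields
`X_H` and `X_H^γ` are `γ`-related iff `d_ϑ(H∘γ) = 0`. -/
theorem stmt_9 (n : ℕ) (hn : 1 ≤ n)
    (ϑ : (Fin n → ℝ) → (Fin n → ℝ)) (hϑ : ContDiff ℝ (⊤ : ℕ∞) ϑ)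
    (hϑclosed : ∀ (i j : Fin n) (q : Fin n → ℝ),
      fderiv ℝ (fun q' => ϑ q' i) q (Pi.single j 1) =
        fderiv ℝ (fun q' => ϑ q' j) q (Pi.single i 1))
    (H : (Fin n → ℝ) × (Fin n → ℝ) → ℝ) (hH : ContDiff ℝ (⊤ : ℕ∞) H)
    (γ : (Fin n → ℝ) → (Fin n → ℝ)) (hγ : ContDiff ℝ (⊤ : ℕ∞) γ)
    (hdγ : ∀ (i k : Fin n) (q : Fin n → ℝ),
      fderiv ℝ (fun q' => γ q' k) q (Pi.single i 1) - ϑ q i * γ q k =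
        fderiv ℝ (fun q' => γ q' i) q (Pi.single k 1) - ϑ q k * γ q i) :
    (∀ q : Fin n → ℝ,
        fderiv ℝ γ q (fun i => fderiv ℝ H (q, γ q) ((0 : Fin n → ℝ), Pi.single i 1)) =
        fun k =>
          - fderiv ℝ H (q, γ q) (Pi.single k 1, (0 : Fin n → ℝ))
          + H (q, γ q) * ϑ q k
          + γ q k * ∑ i, ϑ q i * fderiv ℝ H (q, γ q) ((0 : Fin n → ℝ), Pi.single i 1)
          - ϑ q k * ∑ j, γ q j * fderiv ℝ H (q, γ q) ((0 : Fin n → ℝ), Pi.single j 1)) ↔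
    (∀ (i : Fin n) (q : Fin n → ℝ),
        fderiv ℝ (fun q' => H (q', γ q')) q (Pi.single i 1) = ϑ q i * H (q, γ q)) := by
  have hHd : Differentiable ℝ H := hH.differentiable (by simp)
  have hγd : Differentiable ℝ γ := hγ.differentiable (by simp)
  have hcomp : ∀ (k : Fin n) (q w : Fin n → ℝ),
      fderiv ℝ (fun q' => γ q' k) q w = fderiv ℝ γ q w k := fun k q w => by
    rw [(hasFDerivAt_pi'.1 (hγd q).hasFDerivAt k).fderiv]
    rfl
  simp only [hcomp] at hdγ
  have hpush : ∀ (q v : Fin n → ℝ) (k : Fin n),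
      fderiv ℝ γ q v k = ∑ i, fderiv ℝ γ q (Pi.single k 1) i * v i +
        γ q k * ∑ i, ϑ q i * v i - ϑ q k * ∑ i, γ q i * v i := fun q v k => by
    rw [(fderiv ℝ γ q).apply_eq_sum_single v, Finset.sum_apply, Finset.mul_sum, Finset.mul_sum,
      ← Finset.sum_add_distrib, ← Finset.sum_sub_distrib]
    refine Finset.sum_congr rfl fun i _ => ?_
    simp only [Pi.smul_apply, smul_eq_mul]
    linear_combination v i * hdγ i k q
  simp only [funext_iff, fderiv_comp_graph_apply_s9 (hHd _) (hγd _)]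
  constructor
  · intro h i q
    linear_combination h q i -
      hpush q (fun i => fderiv ℝ H (q, γ q) ((0 : Fin n → ℝ), Pi.single i 1)) i
  · intro h q k
    linear_combination h k q +
      hpush q (fun i => fderiv ℝ H (q, γ q) ((0 : Fin n → ℝ), Pi.single i 1)) k
end

section
/- Let n ≥ 1 and H : ℝⁿ × ℝⁿ × ℝ → ℝ smooth (coordinates (q, p, z)), with contact Hamiltonian vector field X_H having components q̇ⁱ = ∂H/∂pᵢ, ṗᵢ = −∂H/∂qⁱ − pᵢ(∂H/∂z), ż = Σᵢpᵢ(∂H/∂pᵢ) − H. Let γ : ℝⁿ × ℝ → ℝⁿ be a smooth section (q,z) ↦ γ(q,z) satisfying the coordinate form of the coisotropic/Lagrangian hypotheses: ∂γᵢ/∂qʲ = ∂γⱼ/∂qⁱ for all i, j (at each fixed z), and ∂γᵢ/∂z = σ·γᵢ for some smooth function σ(q,z) and all i. Let X_H^γ(q,z) = ((∂H/∂pᵢ), Σᵢγᵢ(∂H/∂pᵢ) − H), all evaluated at (q, γ(q,z), z). Then X_H and X_H^γ are γ-related (the derivative of (q,z) ↦ (q, γ(q,z), z) sends X_H^γ(q,z)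 to X_H(q, γ(q,z), z)) if and only if for all j, q, z: ∂H/∂qʲ + Σᵢ(∂H/∂pᵢ)(∂γᵢ/∂qʲ) + γⱼ·(∂H/∂z + Σᵢ(∂H/∂pᵢ)(∂γᵢ/∂z)) − H·(∂γⱼ/∂z) = 0, with all derivatives of H evaluated at (q, γ(q,z), z). -/
noncomputable section

/-- The contact Hamiltonian vector field of `H(q,p,z)` on `T*ℝⁿ × ℝ` with contact
form `η = dz − pᵢdqⁱ`: components `(∂H/∂pᵢ, −∂H/∂qⁱ − pᵢ∂H/∂z, pᵢ∂H/∂pᵢ − H)`. -/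
def contactVF (n : ℕ) (H : (Fin n → ℝ) × (Fin n → ℝ) × ℝ → ℝ) :
    (Fin n → ℝ) × (Fin n → ℝ) × ℝ → (Fin n → ℝ) × (Fin n → ℝ) × ℝ :=
  fun w =>
    ((fun i => fderiv ℝ H w ((0 : Fin n → ℝ), Pi.single i 1, (0 : ℝ))),
     (fun i => - fderiv ℝ H w (Pi.single i 1, (0 : Fin n → ℝ), (0 : ℝ))
        - w.2.1 i * fderiv ℝ H w ((0 : Fin n → ℝ), (0 : Fin n → ℝ), (1 : ℝ))),
     (∑ i, w.2.1 i * fderiv ℝ H w ((0 : Fin n → ℝ), Pi.single i 1, (0 : ℝ))) - H w)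

/-- A linear functional on `ℝⁿ × ℝ` is determined by its values on the coordinate vectors. -/
theorem clm_prod_apply_eq_sum {n : ℕ} (L : (Fin n → ℝ) × ℝ →L[ℝ] ℝ) (v : Fin n → ℝ) (w : ℝ) :
    L (v, w) = ∑ i, v i * L (Pi.single i 1, 0) + w * L (0, 1) := by
  have hv : L (v, 0) = ∑ i, v i * L (Pi.single i 1, 0) := by
    have h := congrArg (L.comp (ContinuousLinearMap.inl ℝ _ _))
      ((Pi.basisFun ℝ (Fin n)).sum_repr v)
    simpa [map_sum] using h.symm
  have hw : L (0, w) = w * L (0, 1) := by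
    rw [← smul_eq_mul, ← map_smul]
    simp
  rw [← hv, ← hw, ← map_add]
  simp

/-- Partial derivatives in the first variable, as directional derivatives of the full map. -/
theorem fderiv_comp_prodMk_left {n : ℕ} {f : (Fin n → ℝ) × ℝ → ℝ} (hf : Differentiable ℝ f)
    (x : (Fin n → ℝ) × ℝ) (v : Fin n → ℝ) :
    fderiv ℝ (fun q => f (q, x.2)) x.1 v = fderiv ℝ f x (v, 0) := by
  have h : HasFDerivAt (fun q => f (q, x.2))
      ((fderiv ℝ f x).comp (ContinuousLinearMap.inl ℝ _ _)) x.1 :=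
    (hf x).hasFDerivAt.comp x.1 (hasFDerivAt_prodMk_left x.1 x.2)
  rw [h.fderiv]
  simp

/-- Derivative of the section `(q, z) ↦ (q, γ (q, z), z)`. -/
theorem fderiv_section_apply {n : ℕ} {γ : (Fin n → ℝ) × ℝ → (Fin n → ℝ)}
    (hγ : Differentiable ℝ γ) (x u : (Fin n → ℝ) × ℝ) :
    fderiv ℝ (fun y : (Fin n → ℝ) × ℝ => (y.1, γ y, y.2)) x u =
      (u.1, fun j => fderiv ℝ (fun y => γ y j) x u, u.2) := by
  have h : HasFDerivAt (fun y : (Fin n → ℝ) × ℝ => (y.1, γ y, y.2)) _ x :=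
    hasFDerivAt_fst.prodMk ((hγ x).hasFDerivAt.prodMk hasFDerivAt_snd)
  have hj (j : Fin n) : fderiv ℝ (fun y => γ y j) x u = fderiv ℝ γ x u j := by
    rw [(hasFDerivAt_pi'.1 (hγ x).hasFDerivAt j).fderiv]
    rfl
  rw [h.fderiv]
  simp [hj]

/-- **Hamilton–Jacobi theorem for contact Hamiltonian systems, Approach I.**
For a section `γ(q,z)` of `T*ℝⁿ × ℝ → ℝⁿ × ℝ` satisfying the
coisotropic/Lagrangian hypotheses (`d_Qγ = 0` and `∂γ/∂z = σγ`), the contact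
Hamiltonian vector field `X_H` and the projected field `X_H^γ` are `γ`-related
iff the contact Hamilton–Jacobi equation holds. -/
theorem stmt_10 (n : ℕ) (hn : 1 ≤ n)
    (H : (Fin n → ℝ) × (Fin n → ℝ) × ℝ → ℝ) (hH : ContDiff ℝ (⊤ : ℕ∞) H)
    (γ : (Fin n → ℝ) × ℝ → (Fin n → ℝ)) (hγ : ContDiff ℝ (⊤ : ℕ∞) γ)
    (hclosed : ∀ (i j : Fin n) (q : Fin n → ℝ) (z : ℝ),
      fderiv ℝ (fun q' => γ (q', z) i) q (Pi.single j 1) =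
        fderiv ℝ (fun q' => γ (q', z) j) q (Pi.single i 1))
    (σ : (Fin n → ℝ) × ℝ → ℝ) (hσ : ContDiff ℝ (⊤ : ℕ∞) σ)
    (hz : ∀ (i : Fin n) (x : (Fin n → ℝ) × ℝ),
      fderiv ℝ (fun y => γ y i) x ((0 : Fin n → ℝ), (1 : ℝ)) = σ x * γ x i) :
    (∀ x : (Fin n → ℝ) × ℝ,
        fderiv ℝ (fun y : (Fin n → ℝ) × ℝ =>
            ((y.1, γ y, y.2) : (Fin n → ℝ) × (Fin n → ℝ) × ℝ)) x
          ((fun i => fderiv ℝ H (x.1, γ x, x.2)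
              ((0 : Fin n → ℝ), Pi.single i 1, (0 : ℝ))),
           (∑ i, γ x i * fderiv ℝ H (x.1, γ x, x.2)
              ((0 : Fin n → ℝ), Pi.single i 1, (0 : ℝ))) - H (x.1, γ x, x.2)) =
        contactVF n H (x.1, γ x, x.2)) ↔
    (∀ (j : Fin n) (x : (Fin n → ℝ) × ℝ),
        fderiv ℝ H (x.1, γ x, x.2) (Pi.single j 1, (0 : Fin n → ℝ), (0 : ℝ)) +
        (∑ i, fderiv ℝ H (x.1, γ x, x.2) ((0 : Fin n → ℝ), Pi.single i 1, (0 : ℝ)) *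
            fderiv ℝ (fun y => γ y i) x (Pi.single j 1, (0 : ℝ))) +
        γ x j * (fderiv ℝ H (x.1, γ x, x.2) ((0 : Fin n → ℝ), (0 : Fin n → ℝ), (1 : ℝ)) +
          ∑ i, fderiv ℝ H (x.1, γ x, x.2) ((0 : Fin n → ℝ), Pi.single i 1, (0 : ℝ)) *
            fderiv ℝ (fun y => γ y i) x ((0 : Fin n → ℝ), (1 : ℝ))) -
        H (x.1, γ x, x.2) * fderiv ℝ (fun y => γ y j) x ((0 : Fin n → ℝ), (1 : ℝ)) = 0) := by
  have hd : Differentiable ℝ γ := hγ.differentiable (by simp)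
  have hsymm (i j : Fin n) (x : (Fin n → ℝ) × ℝ) :
      fderiv ℝ (fun y => γ y j) x (Pi.single i 1, 0) =
        fderiv ℝ (fun y => γ y i) x (Pi.single j 1, 0) := by
    rw [← fderiv_comp_prodMk_left (differentiable_pi.1 hd j),
      ← fderiv_comp_prodMk_left (differentiable_pi.1 hd i)]
    exact hclosed j i x.1 x.2
  rw [forall_comm]
  refine forall_congr' fun x => ?_
  simp only [fderiv_section_apply hd, contactVF, Prod.mk.injEq, true_and, and_true, funext_iff]
  refine forall_congr' fun j => ?_
  rw [clm_prod_apply_eq_sum]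
  simp only [hsymm _ j, hz]
  have hsum : ∑ i, fderiv ℝ H (x.1, γ x, x.2) (0, Pi.single i 1, 0) * (σ x * γ x i) =
      σ x * ∑ i, γ x i * fderiv ℝ H (x.1, γ x, x.2) (0, Pi.single i 1, 0) := by
    rw [Finset.mul_sum]
    exact Finset.sum_congr rfl fun i _ => by ring
  rw [hsum]
  constructor <;> intro h <;> linear_combination h
end
end

section
/- Let n ≥ 1 and H : ℝⁿ × ℝⁿ × ℝ → ℝ smooth (coordinates (q, p, z)), with contact Hamiltonian vector field X_H having components q̇ⁱ = ∂H/∂pᵢ, ṗᵢ = −∂H/∂qⁱ − pᵢ(∂H/∂z), ż = Σᵢpᵢ(∂H/∂pᵢ) − H. Let f : ℝⁿ → ℝ be smooth and let γ : ℝⁿ → ℝⁿ × ℝⁿ × ℝ be its first jet prolongation, γ(q) = (q, ∇f(q), f(q)) (so the image of γ is a Legendrian submanifold of the contact manifold (T*ℝⁿ × ℝ, dz − pᵢdqⁱ)). Let X_H^γ(q) ∈ ℝⁿ have components (∂H/∂pᵢ)(q, ∇f(q), f(q)). Then X_H and X_H^γ are γ-related (i.e. Dγ(q)(X_H^γ(q))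 = X_H(γ(q)) for all q) if and only if H ∘ γ = 0, i.e. H(q, ∇f(q), f(q)) = 0 for all q. -/
noncomputable section

/-- A linear functional on `ℝⁿ` is determined by its values on the standard basis. -/
lemma ContinuousLinearMap.apply_eq_sum_mul_single {n : ℕ} (L : (Fin n → ℝ) →L[ℝ] ℝ)
    (v : Fin n → ℝ) : L v = ∑ i, v i * L (Pi.single i 1) := by
  conv_lhs => rw [pi_eq_sum_univ' v]
  simp [map_sum]

/-- The derivative of the first jet prolongation of a `C²` function. -/
lemma hasFDerivAt_jetProlongation {n : ℕ} {f : (Fin n → ℝ) → ℝ} (hf : ContDiff ℝ 2 f)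
    (q : Fin n → ℝ) :
    HasFDerivAt (fun q' : Fin n → ℝ =>
        ((q', fun i => fderiv ℝ f q' (Pi.single i 1), f q') :
          (Fin n → ℝ) × (Fin n → ℝ) × ℝ))
      ((ContinuousLinearMap.id ℝ (Fin n → ℝ)).prod
        ((ContinuousLinearMap.pi fun i =>
          (fderiv ℝ (fderiv ℝ f) q).flip (Pi.single i 1)).prod (fderiv ℝ f q))) q := by
  have hdf : DifferentiableAt ℝ (fderiv ℝ f) q :=
    (hf.fderiv_right (m := 1) (by norm_num)).differentiable (by norm_num) q
  refine (hasFDerivAt_id q).prodMk (HasFDerivAt.prodMk (hasFDerivAt_pi.2 fun i => ?_)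
    (hf.differentiable (by norm_num) q).hasFDerivAt)
  have h := hdf.hasFDerivAt.clm_apply (hasFDerivAt_const (Pi.single i (1 : ℝ)) q)
  simpa using h

/-- A linear functional on `ℝⁿ × ℝⁿ × ℝ` splits into its three partial functionals, the middle
one being expanded in the standard basis. -/
lemma ContinuousLinearMap.apply_prod_eq_add_sum_add {n : ℕ}
    (L : (Fin n → ℝ) × (Fin n → ℝ) × ℝ →L[ℝ] ℝ) (u v : Fin n → ℝ) (c : ℝ) :
    L (u, v, c) = L (u, 0, 0) + ∑ i, v i * L (0, Pi.single i 1, 0) + c * L (0, 0, 1) := by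
  have h1 : (u, v, c) = (u, (0 : Fin n → ℝ), (0 : ℝ)) + ((0 : Fin n → ℝ), v, (0 : ℝ))
      + c • ((0 : Fin n → ℝ), (0 : Fin n → ℝ), (1 : ℝ)) := by simp
  have h2 := (L.comp ((ContinuousLinearMap.inr ℝ (Fin n → ℝ) ((Fin n → ℝ) × ℝ)).comp
    (ContinuousLinearMap.inl ℝ (Fin n → ℝ) ℝ))).apply_eq_sum_mul_single v
  simp only [ContinuousLinearMap.comp_apply, ContinuousLinearMap.inl_apply,
    ContinuousLinearMap.inr_apply] at h2
  rw [h1, map_add, map_add, map_smul, h2, smul_eq_mul]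

/-- **Hamilton–Jacobi theorem for contact Hamiltonian systems, Approach II.**
For the first jet prolongation `γ(q) = (q, ∇f(q), f(q))` of a smooth function `f`
(a Legendrian section), `X_H` and `X_H^γ` are `γ`-related iff `H ∘ γ = 0`. -/
theorem stmt_11 (n : ℕ) (hn : 1 ≤ n)
    (H : (Fin n → ℝ) × (Fin n → ℝ) × ℝ → ℝ) (hH : ContDiff ℝ (⊤ : ℕ∞) H)
    (f : (Fin n → ℝ) → ℝ) (hf : ContDiff ℝ (⊤ : ℕ∞) f) :
    (∀ q : Fin n → ℝ,
        fderiv ℝ (fun q' : Fin n → ℝ =>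
            ((q', fun i => fderiv ℝ f q' (Pi.single i 1), f q') :
              (Fin n → ℝ) × (Fin n → ℝ) × ℝ)) q
          (fun i => fderiv ℝ H
              (q, (fun i' => fderiv ℝ f q (Pi.single i' 1)), f q)
              ((0 : Fin n → ℝ), Pi.single i 1, (0 : ℝ))) =
        contactVF n H (q, (fun i' => fderiv ℝ f q (Pi.single i' 1)), f q)) ↔
    (∀ q : Fin n → ℝ,
        H (q, (fun i' => fderiv ℝ f q (Pi.single i' 1)), f q) = 0) := by
  have hf2 : ContDiff ℝ 2 f := contDiff_infty.1 hf 2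
  have hγ := hasFDerivAt_jetProlongation hf2
  constructor
  · intro h q
    have hz := congrArg (fun w => w.2.2) (h q)
    rw [(hγ q).fderiv] at hz
    simp only [contactVF, ContinuousLinearMap.prod_apply] at hz
    rw [(fderiv ℝ f q).apply_eq_sum_mul_single] at hz
    simp only [mul_comm (fderiv ℝ f q _)] at hz
    linarith
  · intro h q
    rw [(hγ q).fderiv]
    refine Prod.ext rfl (Prod.ext (funext fun i => ?_) ?_)
    · have hcomp := ((hH.differentiable (by simp) _).hasFDerivAt.comp q (hγ q)).unique
        ((hasFDerivAt_const (0 : ℝ) q).congr_of_eventuallyEq (.of_forall h))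
      have hi := DFunLike.congr_fun hcomp (Pi.single i 1)
      simp only [ContinuousLinearMap.comp_apply, ContinuousLinearMap.prod_apply,
        zero_apply, ContinuousLinearMap.id_apply] at hi
      rw [ContinuousLinearMap.apply_prod_eq_add_sum_add] at hi
      simp only [ContinuousLinearMap.pi_apply, ContinuousLinearMap.flip_apply] at hi
      have hsymm : IsSymmSndFDerivAt ℝ f q := hf2.contDiffAt.isSymmSndFDerivAt (by simp)
      simp only [contactVF, ContinuousLinearMap.prod_apply, ContinuousLinearMap.pi_apply,
        ContinuousLinearMap.flip_apply]
      rw [hsymm.eq, ContinuousLinearMap.apply_eq_sum_mul_single]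
      simp only [mul_comm (fderiv ℝ (fderiv ℝ f) q _ _)] at hi
      linarith
    · simp only [contactVF, ContinuousLinearMap.prod_apply, h q, sub_zero]
      rw [(fderiv ℝ f q).apply_eq_sum_mul_single]
      simp only [mul_comm (fderiv ℝ f q _)]
end
end

section
/- Let n, m ≥ 1. Let ρⁱ_α : ℝⁿ → ℝ (i = 1,…,n; α = 1,…,m) and C^γ_{αβ} : ℝⁿ → ℝ (α,β,γ = 1,…,m) be smooth, with C^γ_{αβ} = −C^γ_{βα} (the local data of a skew-symmetric/almost Lie algebroid). Let H : ℝⁿ × ℝᵐ → ℝ be smooth, and define the almost-Poisson Hamiltonian vector field on ℝⁿ × ℝᵐ by q̇ⁱ = Σ_β ρⁱ_β(∂H/∂p_β), ṗ_α = −(Σᵢ ρⁱ_α(∂H/∂qⁱ) + Σ_{β,γ} C^γ_{αβ}p_γ(∂H/∂p_β)). Let ψ : ℝⁿ → ℝᵐ be smooth with d^Dψ = 0, i.e. Σ_γ C^γ_{δβ}(q)ψ_γ(q) = Σᵢ [ρⁱ_δ(q)(∂ψ_β/∂qⁱ)(q) − ρⁱ_β(q)(∂ψ_δ/∂qⁱ)(q)]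 for all δ, β, q. Let the projected vector field be X^ψ(q) ∈ ℝⁿ with components Σ_β ρⁱ_β(q)(∂H/∂p_β)(q,ψ(q)). Then X^ψ and the Hamiltonian vector field are ψ-related (i.e. Dψ(q)(X^ψ(q)) equals the p-component of the Hamiltonian vector field at (q, ψ(q)) for all q) if and only if d^D(H∘ψ) = 0, i.e. Σᵢ ρⁱ_γ(q)·[ (∂H/∂qⁱ)(q,ψ(q)) + Σ_β (∂ψ_β/∂qⁱ)(q)(∂H/∂p_β)(q,ψ(q)) ] = 0 for all γ, q. -/
/-- The components of the derivative of a vector-valued map, in terms of partial derivatives. -/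
theorem fderiv_apply_eq_sum_partial {ι κ : Type*} [Fintype ι] [DecidableEq ι] [Fintype κ]
    {f : (ι → ℝ) → κ → ℝ} {x : ι → ℝ} (hf : DifferentiableAt ℝ f x) (v : ι → ℝ) (a : κ) :
    fderiv ℝ f x v a = ∑ i, v i * fderiv ℝ (fun y => f y a) x (Pi.single i 1) := by
  rw [fderiv_apply hf a]
  conv_lhs => rw [pi_eq_sum_univ' v]
  simp [map_sum, Finset.sum_apply]

/-- If the structure coefficients `c` are the antisymmetrized contraction of the anchor `r` with
the Jacobian `J`, the defect of relatedness is the anchor applied to the total differential. -/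
theorem sum_anchor_mul_total_differential {ι κ : Type*} [Fintype ι] [Fintype κ]
    (r : ι → κ → ℝ) (c : κ → κ → κ → ℝ) (s : κ → ℝ) (J : ι → κ → ℝ) (u : ι → ℝ) (w : κ → ℝ)
    (a : κ) (hc : ∀ b, ∑ g, c g a b * s g = ∑ i, (r i a * J i b - r i b * J i a)) :
    ∑ i, r i a * (u i + ∑ b, J i b * w b) =
      ∑ i, (∑ b, r i b * w b) * J i a +
        (∑ i, r i a * u i + ∑ b, ∑ g, c g a b * s g * w b) := by
  have hcw : ∑ b, ∑ g, c g a b * s g * w b =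
      ∑ i, ∑ b, (r i a * J i b - r i b * J i a) * w b := by
    simp_rw [← Finset.sum_mul, hc, Finset.sum_mul]
    exact Finset.sum_comm
  rw [hcw, ← Finset.sum_add_distrib, ← Finset.sum_add_distrib]
  refine Finset.sum_congr rfl fun i _ => ?_
  rw [mul_add, Finset.mul_sum, Finset.sum_mul, add_left_comm, ← Finset.sum_add_distrib]
  congr 1
  exact Finset.sum_congr rfl fun b _ => by ring


/-- **Hamilton–Jacobi theorem for linear almost Poisson structures** (on the dual of
a skew-symmetric algebroid with anchor `ρⁱ_α` and structure functions `C^γ_{αβ}`).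
For a section `ψ` with `d^Dψ = 0`, the projected field `X^ψ` and the
almost-Poisson Hamiltonian vector field are `ψ`-related iff `d^D(H∘ψ) = 0`. -/
theorem stmt_13 (n m : ℕ) (hn : 1 ≤ n) (hm : 1 ≤ m)
    (ρ : Fin n → Fin m → (Fin n → ℝ) → ℝ)
    (hρ : ∀ i a, ContDiff ℝ (⊤ : ℕ∞) (ρ i a))
    (C : Fin m → Fin m → Fin m → (Fin n → ℝ) → ℝ)
    (hC : ∀ g a b, ContDiff ℝ (⊤ : ℕ∞) (C g a b))
    (hCskew : ∀ g a b q, C g a b q = - C g b a q)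
    (H : (Fin n → ℝ) × (Fin m → ℝ) → ℝ) (hH : ContDiff ℝ (⊤ : ℕ∞) H)
    (ψ : (Fin n → ℝ) → (Fin m → ℝ)) (hψ : ContDiff ℝ (⊤ : ℕ∞) ψ)
    (hdψ : ∀ (δ β : Fin m) (q : Fin n → ℝ),
      ∑ g, C g δ β q * ψ q g =
        ∑ i, (ρ i δ q * fderiv ℝ (fun q' => ψ q' β) q (Pi.single i 1) -
              ρ i β q * fderiv ℝ (fun q' => ψ q' δ) q (Pi.single i 1))) :
    (∀ q : Fin n → ℝ,
        fderiv ℝ ψ q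
          (fun i => ∑ β, ρ i β q *
            fderiv ℝ H (q, ψ q) ((0 : Fin n → ℝ), Pi.single β 1)) =
        fun α => - ((∑ i, ρ i α q * fderiv ℝ H (q, ψ q) (Pi.single i 1, (0 : Fin m → ℝ))) +
          ∑ β, ∑ g, C g α β q * ψ q g *
            fderiv ℝ H (q, ψ q) ((0 : Fin n → ℝ), Pi.single β 1))) ↔
    (∀ (g : Fin m) (q : Fin n → ℝ),
        ∑ i, ρ i g q *
          (fderiv ℝ H (q, ψ q) (Pi.single i 1, (0 : Fin m → ℝ)) +
           ∑ β, fderiv ℝ (fun q' => ψ q' β) q (Pi.single i 1) *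
             fderiv ℝ H (q, ψ q) ((0 : Fin n → ℝ), Pi.single β 1)) = 0) := by
  have hrelated (q : Fin n → ℝ) (a : Fin m) := sum_anchor_mul_total_differential
    (fun i a => ρ i a q) (fun g a b => C g a b q) (ψ q)
    (fun i b => fderiv ℝ (fun q' => ψ q' b) q (Pi.single i 1))
    (fun i => fderiv ℝ H (q, ψ q) (Pi.single i 1, (0 : Fin m → ℝ)))
    (fun b => fderiv ℝ H (q, ψ q) ((0 : Fin n → ℝ), Pi.single b 1)) a (fun b => hdψ a b q)
  have hψd : Differentiable ℝ ψ := hψ.differentiable (by simp)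
  rw [forall_comm (α := Fin m)]
  refine forall_congr' fun q => ?_
  rw [funext_iff]
  refine forall_congr' fun a => ?_
  rw [fderiv_apply_eq_sum_partial (hψd q), hrelated q a, eq_neg_iff_add_eq_zero]
end

section
/- Let U ⊆ ℝⁿ be open and connected, and let X₁,…,X_m : U → ℝⁿ be smooth vector fields. Define inductively B₁ = {X₁,…,X_m} and B_{k+1} = B_k ∪ {[X,Y] : X,Y ∈ B_k}, where [X,Y](q) = DY(q)(X(q)) − DX(q)(Y(q)) is the Lie bracket. Assume the family is completely nonholonomic (bracket-generating): for every q ∈ U, the set {Z(q) : Z ∈ ⋃_k B_k} spans ℝⁿ. If f : U → ℝ is smooth and Df(q)(X_α(q)) = 0 for every q ∈ U and every α = 1,…,m, then f is constant on U. (In particular, there is no non-zero exact one-form in the annihilator of a completely nonholonomic distribution on a connected manifold.) -/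
noncomputable section

/-- The Lie bracket of vector fields on `ℝⁿ`:
`[X,Y](q) = DY(q)(X(q)) − DX(q)(Y(q))`. -/
def vbracket (n : ℕ) (X Y : (Fin n → ℝ) → (Fin n → ℝ)) :
    (Fin n → ℝ) → (Fin n → ℝ) :=
  fun q => fderiv ℝ Y q (X q) - fderiv ℝ X q (Y q)

/-- The iterated bracket families: `B₁ = {X₁,…,X_m}`,
`B_{k+1} = B_k ∪ {[X,Y] : X,Y ∈ B_k}`. -/
def brkFam (n m : ℕ) (X : Fin m → (Fin n → ℝ) → (Fin n → ℝ)) :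
    ℕ → Set ((Fin n → ℝ) → (Fin n → ℝ))
  | 0 => Set.range X
  | k + 1 => brkFam n m X k ∪
      {Z | ∃ A ∈ brkFam n m X k, ∃ B ∈ brkFam n m X k, Z = vbracket n A B}

/-- Brackets of vector fields smooth on an open set are smooth there. -/
theorem contDiffOn_vbracket {n : ℕ} {U : Set (Fin n → ℝ)} (hU : IsOpen U)
    {A B : (Fin n → ℝ) → (Fin n → ℝ)} (hA : ContDiffOn ℝ (⊤ : ℕ∞) A U)
    (hB : ContDiffOn ℝ (⊤ : ℕ∞) B U) : ContDiffOn ℝ (⊤ : ℕ∞) (vbracket n A B) U := fun x hx =>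
  (ContDiffAt.lieBracket_vectorField (hA.contDiffAt (hU.mem_nhds hx))
    (hB.contDiffAt (hU.mem_nhds hx)) (by simp)).contDiffWithinAt

/-- If a smooth function is annihilated by two smooth vector fields on an open set, then it is
annihilated by their bracket. -/
theorem fderiv_apply_vbracket_eq_zero {n : ℕ} {U : Set (Fin n → ℝ)} (hU : IsOpen U)
    {A B : (Fin n → ℝ) → (Fin n → ℝ)} (hA : ContDiffOn ℝ (⊤ : ℕ∞) A U)
    (hB : ContDiffOn ℝ (⊤ : ℕ∞) B U) {f : (Fin n → ℝ) → ℝ}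
    (hf : ContDiffOn ℝ (⊤ : ℕ∞) f U) (hfA : ∀ q ∈ U, fderiv ℝ f q (A q) = 0)
    (hfB : ∀ q ∈ U, fderiv ℝ f q (B q) = 0) :
    ∀ q ∈ U, fderiv ℝ f q (vbracket n A B q) = 0 := by
  intro q hq
  have hUq := hU.mem_nhds hq
  have hAB := VectorField.fderiv_apply_lieBracket (hf.contDiffAt hUq)
    (by simpa using WithTop.coe_le_coe.2 (le_top : (2 : ℕ∞) ≤ ⊤)) ((hB.contDiffAt hUq).differentiableAt (by simp))
    ((hA.contDiffAt hUq).differentiableAt (by simp))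
  have hA0 : (fun x => fderiv ℝ f x (A x)) =ᶠ[nhds q] fun _ => 0 :=
    Filter.eventually_of_mem hUq hfA
  have hB0 : (fun x => fderiv ℝ f x (B x)) =ᶠ[nhds q] fun _ => 0 :=
    Filter.eventually_of_mem hUq hfB
  change fderiv ℝ f q (VectorField.lieBracket ℝ A B q) = 0
  rw [hAB, hA0.fderiv_eq, hB0.fderiv_eq]
  simp

/-- The iterated brackets of smooth vector fields annihilating a smooth function are smooth and
annihilate that function. -/
theorem contDiffOn_and_fderiv_apply_eq_zero_of_mem_brkFam {n m : ℕ} {U : Set (Fin n → ℝ)}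
    (hU : IsOpen U) {X : Fin m → (Fin n → ℝ) → (Fin n → ℝ)}
    (hX : ∀ α, ContDiffOn ℝ (⊤ : ℕ∞) (X α) U) {f : (Fin n → ℝ) → ℝ}
    (hf : ContDiffOn ℝ (⊤ : ℕ∞) f U) (hdf : ∀ q ∈ U, ∀ α, fderiv ℝ f q (X α q) = 0) (k : ℕ) :
    ∀ Z ∈ brkFam n m X k,
      ContDiffOn ℝ (⊤ : ℕ∞) Z U ∧ ∀ q ∈ U, fderiv ℝ f q (Z q) = 0 := by
  induction k with
  | zero =>
    rintro _ ⟨α, rfl⟩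
    exact ⟨hX α, fun q hq => hdf q hq α⟩
  | succ k ih =>
    rintro Z (hZ | ⟨A, hA, B, hB, rfl⟩)
    · exact ih Z hZ
    · obtain ⟨hAs, hA0⟩ := ih A hA
      obtain ⟨hBs, hB0⟩ := ih B hB
      exact ⟨contDiffOn_vbracket hU hAs hBs,
        fderiv_apply_vbracket_eq_zero hU hAs hBs hf hA0 hB0⟩

/-- **Chow–Rashevskii consequence.** If `X₁,…,X_m` is a completely nonholonomic
(bracket-generating) family of smooth vector fields on an open connected `U ⊆ ℝⁿ`
and `f` is smooth with `df(X_α) = 0` on `U`, then `f` is constant on `U`: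
there is no non-zero exact one-form in the annihilator of a completely
nonholonomic distribution. -/
theorem stmt_14 (n m : ℕ) (hn : 1 ≤ n) (hm : 1 ≤ m)
    (U : Set (Fin n → ℝ)) (hUopen : IsOpen U) (hUconn : IsConnected U)
    (X : Fin m → (Fin n → ℝ) → (Fin n → ℝ))
    (hX : ∀ α, ContDiffOn ℝ (⊤ : ℕ∞) (X α) U)
    (hbg : ∀ q ∈ U,
      Submodule.span ℝ {v : Fin n → ℝ | ∃ k, ∃ Z ∈ brkFam n m X k, v = Z q} = ⊤)
    (f : (Fin n → ℝ) → ℝ) (hf : ContDiffOn ℝ (⊤ : ℕ∞) f U)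
    (hdf : ∀ q ∈ U, ∀ α, fderiv ℝ f q (X α q) = 0) :
    ∀ x ∈ U, ∀ y ∈ U, f x = f y := by
  intro x hx y hy
  refine hUopen.is_const_of_fderiv_eq_zero hUconn.isPreconnected
    (hf.differentiableOn (by simp)) (fun q hq => ?_) hx hy
  have hspan : Submodule.span ℝ {v : Fin n → ℝ | ∃ k, ∃ Z ∈ brkFam n m X k, v = Z q} ≤
      LinearMap.ker (fderiv ℝ f q).toLinearMap := by
    rw [Submodule.span_le]
    rintro _ ⟨k, Z, hZ, rfl⟩
    exact (contDiffOn_and_fderiv_apply_eq_zero_of_mem_brkFam hUopen hX hf hdf k Z hZ).2 q hq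
  rw [hbg q hq] at hspan
  ext1 v
  exact hspan Submodule.mem_top
end
end

section
/- Let n ≥ 1, 1 ≤ k < n, H : ℝⁿ × ℝⁿ → ℝ smooth, and ψᵃᵢ : ℝⁿ → ℝ smooth (a = 1,…,k; i = 1,…,n) the coefficients of linear velocity constraints. Define the momentum constraints Ψᵃ(q,p) = Σᵢ ψᵃᵢ(q)(∂H/∂pᵢ)(q,p) and the matrix Cᵃᵇ(q,p) = Σ_{i,j} ψᵃᵢ(q)ψᵇⱼ(q)(∂²H/∂pᵢ∂pⱼ)(q,p). Let σ : ℝⁿ → ℝⁿ be smooth with: (a) Ψᵃ(q, σ(q)) = 0 for all a, q (the image of σ lies in the constraint manifold M); (b) the compatibility condition: the matrix (Cᵃᵇ(q, σ(q))) is invertible for every q; (c) dσ ∈ I(N°): for every q and every pair of vectors v, w ∈ ℝⁿ with Σᵢψᵃᵢ(q)vᵢ = Σᵢψᵃᵢ(q)wᵢ = 0 for all a, one has ⟨Dσ(q)v, w⟩ = ⟨Dσ(q)w, v⟩. Define the nonholonomic vector field X_{H,M}(q,p) = X_H(q,p) − Σ_{a,b} C_{ab}(q,p)·(X_HΨᵇ)(q,p)·Zᵃ(q),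 where X_H(q,p) = (∂H/∂pᵢ, −∂H/∂qⁱ), (C_{ab}) is the inverse of (Cᵃᵇ), X_HΨᵇ = Σᵢ[(∂H/∂pᵢ)(∂Ψᵇ/∂qⁱ) − (∂H/∂qⁱ)(∂Ψᵇ/∂pᵢ)], and Zᵃ(q) has zero q-components and p-components ψᵃᵢ(q); and let X^σ(q) = ∇_pH(q, σ(q)) be its projection. Then the following are equivalent: (i) X^σ and X_{H,M} are σ-related, i.e. Dσ(q)(X^σ(q)) equals the p-component of X_{H,M}(q, σ(q)) for all q; (ii) d(H∘σ) ∈ N°: for every q and every v ∈ ℝⁿ with Σᵢψᵃᵢ(q)vᵢ = 0 for all a, the derivative of q ↦ H(q, σ(q)) at q in the direction v vanishes. -/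
noncomputable section

/-- `∂H/∂qⁱ` on `T*ℝⁿ = ℝⁿ × ℝⁿ`. -/
def Hq (n : ℕ) (H : (Fin n → ℝ) × (Fin n → ℝ) → ℝ) (i : Fin n)
    (w : (Fin n → ℝ) × (Fin n → ℝ)) : ℝ :=
  fderiv ℝ H w (Pi.single i 1, (0 : Fin n → ℝ))

/-- `∂H/∂pᵢ`. -/
def Hp (n : ℕ) (H : (Fin n → ℝ) × (Fin n → ℝ) → ℝ) (i : Fin n)
    (w : (Fin n → ℝ) × (Fin n → ℝ)) : ℝ :=
  fderiv ℝ H w ((0 : Fin n → ℝ), Pi.single i 1)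

/-- Momentum constraints `Ψᵃ(q,p) = Σᵢ ψᵃᵢ(q)(∂H/∂pᵢ)(q,p)`. -/
def Psi (n k : ℕ) (H : (Fin n → ℝ) × (Fin n → ℝ) → ℝ)
    (ψc : Fin k → Fin n → (Fin n → ℝ) → ℝ) (a : Fin k)
    (w : (Fin n → ℝ) × (Fin n → ℝ)) : ℝ :=
  ∑ i, ψc a i w.1 * Hp n H i w

/-- The matrix `Cᵃᵇ(q,p) = Σ_{i,j} ψᵃᵢ(q)ψᵇⱼ(q)(∂²H/∂pᵢ∂pⱼ)(q,p)`. -/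
def Cmat (n k : ℕ) (H : (Fin n → ℝ) × (Fin n → ℝ) → ℝ)
    (ψc : Fin k → Fin n → (Fin n → ℝ) → ℝ)
    (w : (Fin n → ℝ) × (Fin n → ℝ)) : Matrix (Fin k) (Fin k) ℝ :=
  fun a b => ∑ i, ∑ j, ψc a i w.1 * ψc b j w.1 *
    fderiv ℝ (fun w' => Hp n H j w') w ((0 : Fin n → ℝ), Pi.single i 1)

/-- `X_HΨᵇ = Σᵢ[(∂H/∂pᵢ)(∂Ψᵇ/∂qⁱ) − (∂H/∂qⁱ)(∂Ψᵇ/∂pᵢ)]`. -/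
def XHPsi (n k : ℕ) (H : (Fin n → ℝ) × (Fin n → ℝ) → ℝ)
    (ψc : Fin k → Fin n → (Fin n → ℝ) → ℝ) (b : Fin k)
    (w : (Fin n → ℝ) × (Fin n → ℝ)) : ℝ :=
  ∑ i, (Hp n H i w * fderiv ℝ (Psi n k H ψc b) w (Pi.single i 1, (0 : Fin n → ℝ)) -
        Hq n H i w * fderiv ℝ (Psi n k H ψc b) w ((0 : Fin n → ℝ), Pi.single i 1))

/-- The `p`-component of the nonholonomic vector field
`X_{H,M} = X_H − Σ_{a,b} C_{ab}·(X_HΨᵇ)·Zᵃ` (the `q`-component is `∂H/∂pᵢ`). -/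
def XHMp (n k : ℕ) (H : (Fin n → ℝ) × (Fin n → ℝ) → ℝ)
    (ψc : Fin k → Fin n → (Fin n → ℝ) → ℝ)
    (w : (Fin n → ℝ) × (Fin n → ℝ)) : Fin n → ℝ :=
  fun i => - Hq n H i w -
    ∑ a, ∑ b, (Cmat n k H ψc w)⁻¹ a b * XHPsi n k H ψc b w * ψc a i w.1

theorem clm_prod_pi_apply {n : ℕ} (L : (Fin n → ℝ) × (Fin n → ℝ) →L[ℝ] ℝ) (x y : Fin n → ℝ) :
    L (x, y) = ∑ i, x i * L (Pi.single i 1, (0 : Fin n → ℝ)) +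
      ∑ i, y i * L ((0 : Fin n → ℝ), Pi.single i 1) := by
  have hx := LinearMap.pi_apply_eq_sum_univ
    (L.comp (ContinuousLinearMap.inl ℝ (Fin n → ℝ) (Fin n → ℝ))).toLinearMap x
  have hy := LinearMap.pi_apply_eq_sum_univ
    (L.comp (ContinuousLinearMap.inr ℝ (Fin n → ℝ) (Fin n → ℝ))).toLinearMap y
  have single_eq (i : Fin n) : (fun j => if i = j then (1 : ℝ) else 0) = Pi.single i 1 := by
    ext j; simp [Pi.single_apply, eq_comm]
  simp only [single_eq, ContinuousLinearMap.coe_coe, ContinuousLinearMap.comp_apply,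
    ContinuousLinearMap.inl_apply, ContinuousLinearMap.inr_apply, smul_eq_mul] at hx hy
  rw [← hx, ← hy, ← map_add]
  simp

theorem fderiv_comp_graph {E F G : Type*} [NormedAddCommGroup E] [NormedSpace ℝ E]
    [NormedAddCommGroup F] [NormedSpace ℝ F] [NormedAddCommGroup G] [NormedSpace ℝ G]
    {f : E × F → G} {s : E → F} {q : E} (hf : DifferentiableAt ℝ f (q, s q))
    (hs : DifferentiableAt ℝ s q) (v : E) :
    fderiv ℝ (fun x => f (x, s x)) q v = fderiv ℝ f (q, s q) (v, fderiv ℝ s q v) := by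
  have h : HasFDerivAt (fun x => (x, s x)) _ q := (hasFDerivAt_id q).prodMk hs.hasFDerivAt
  have hc : HasFDerivAt (fun x => f (x, s x)) _ q := hf.hasFDerivAt.comp q h
  rw [hc.fderiv]
  rfl

section Momentum

variable {n k : ℕ} {H : (Fin n → ℝ) × (Fin n → ℝ) → ℝ}
  {ψc : Fin k → Fin n → (Fin n → ℝ) → ℝ}

theorem differentiable_Hp (hH : ContDiff ℝ 2 H) (i : Fin n) :
    Differentiable ℝ (Hp n H i) := by
  have h : Differentiable ℝ (fderiv ℝ H) :=
    (hH.fderiv_right (m := 1) (by norm_num)).differentiable one_ne_zero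
  exact fun w => (h w).clm_apply (differentiableAt_const _)

theorem differentiable_Psi (hH : ContDiff ℝ 2 H)
    (hψ : ∀ a i, Differentiable ℝ (ψc a i)) (a : Fin k) :
    Differentiable ℝ (Psi n k H ψc a) := by
  have hp := differentiable_Hp hH
  unfold Psi
  fun_prop

/-- `Zᵃ(Ψᵇ) = Cᵃᵇ`. -/
theorem fderiv_Psi_vertical (hH : ContDiff ℝ 2 H)
    (hψ : ∀ a i, Differentiable ℝ (ψc a i)) (a b : Fin k)
    (w : (Fin n → ℝ) × (Fin n → ℝ)) :
    fderiv ℝ (Psi n k H ψc b) w ((0 : Fin n → ℝ), fun i => ψc a i w.1) =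
      Cmat n k H ψc w a b := by
  have hd (j : Fin n) : HasFDerivAt (fun w' : (Fin n → ℝ) × (Fin n → ℝ) => ψc b j w'.1)
      ((fderiv ℝ (ψc b j) w.1).comp (ContinuousLinearMap.fst ℝ _ _)) w :=
    (hψ b j w.1).hasFDerivAt.comp w hasFDerivAt_fst
  have h : HasFDerivAt (Psi n k H ψc b) _ w := HasFDerivAt.fun_sum fun j (_ : j ∈ Finset.univ) =>
    (hd j).mul (differentiable_Hp hH j w).hasFDerivAt
  rw [h.fderiv]
  simp only [sum_apply, add_apply,
    smul_apply, ContinuousLinearMap.comp_apply, smul_eq_mul,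
    ContinuousLinearMap.coe_fst', map_zero, mul_zero, add_zero]
  rw [Cmat, Finset.sum_comm]
  refine Finset.sum_congr rfl fun j _ => ?_
  rw [clm_prod_pi_apply]
  simp only [Pi.zero_apply, zero_mul, Finset.sum_const_zero, zero_add, Finset.mul_sum]
  exact Finset.sum_congr rfl fun i _ => by ring

theorem fderiv_Hp_comm (hH : ContDiff ℝ 2 H) (i j : Fin n)
    (w : (Fin n → ℝ) × (Fin n → ℝ)) :
    fderiv ℝ (fun w' => Hp n H j w') w ((0 : Fin n → ℝ), Pi.single i 1) =
      fderiv ℝ (fun w' => Hp n H i w') w ((0 : Fin n → ℝ), Pi.single j 1) := by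
  have h : Differentiable ℝ (fderiv ℝ H) :=
    (hH.fderiv_right (m := 1) (by norm_num)).differentiable one_ne_zero
  have hs : IsSymmSndFDerivAt ℝ H w :=
    hH.contDiffAt.isSymmSndFDerivAt (by simp)
  have he (l : Fin n) (u : (Fin n → ℝ) × (Fin n → ℝ)) :
      fderiv ℝ (fun w' => Hp n H l w') w u =
        fderiv ℝ (fderiv ℝ H) w u ((0 : Fin n → ℝ), Pi.single l 1) := by
    unfold Hp
    rw [fderiv_clm_apply (h w) (differentiableAt_const _)]
    simp
  rw [he, he]
  exact hs.eq _ _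

theorem Cmat_isSymm (hH : ContDiff ℝ 2 H) (w : (Fin n → ℝ) × (Fin n → ℝ)) :
    (Cmat n k H ψc w).IsSymm := by
  refine Matrix.IsSymm.ext fun a b => ?_
  rw [Cmat, Cmat, Finset.sum_comm]
  refine Finset.sum_congr rfl fun i _ => Finset.sum_congr rfl fun j _ => ?_
  rw [fderiv_Hp_comm hH j i]
  ring

theorem XHPsi_eq_fderiv (b : Fin k) (w : (Fin n → ℝ) × (Fin n → ℝ)) :
    XHPsi n k H ψc b w =
      fderiv ℝ (Psi n k H ψc b) w (fun i => Hp n H i w, fun i => -Hq n H i w) := by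
  rw [clm_prod_pi_apply, XHPsi, Finset.sum_sub_distrib]
  simp [sub_eq_add_neg]

end Momentum

/-- A covector vanishing on `⋂ₐ ker Aₐ` is a linear combination of the `Aₐ`. -/
theorem exists_eq_sum_of_annihilates {ι κ : Type*} [Fintype ι] [Fintype κ]
    (A : κ → ι → ℝ) (u : ι → ℝ)
    (h : ∀ v : ι → ℝ, (∀ a, ∑ i, A a i * v i = 0) → ∑ i, u i * v i = 0) :
    ∃ μ : κ → ℝ, ∀ i, u i = ∑ a, μ a * A a i := by
  classical
  let φ : (ι → ℝ) → Module.Dual ℝ (ι → ℝ) := fun x => Fintype.linearCombination ℝ x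
  have hφ (x v : ι → ℝ) : φ x v = ∑ i, x i * v i := by
    simp [φ, Fintype.linearCombination_apply, mul_comm]
  have hmem : φ u ∈ Submodule.span ℝ (Set.range fun a => φ (A a)) := by
    refine mem_span_of_iInf_ker_le_ker fun v hv => ?_
    simp only [Submodule.mem_iInf, LinearMap.mem_ker, hφ] at hv ⊢
    exact h v hv
  obtain ⟨μ, hμ⟩ := (Submodule.mem_span_range_iff_exists_fun ℝ).1 hmem
  refine ⟨μ, fun i => ?_⟩
  have := LinearMap.congr_fun hμ (Pi.single i 1)
  simpa [hφ, Pi.single_apply] using this.symm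

/-- **Hamilton–Jacobi theorem for nonholonomic Hamiltonian systems.**
For a one-form `σ` with image in the constraint manifold `M`, invertible
compatibility matrix, and `dσ ∈ I(N°)`, the projected field and the constrained
dynamics `X_{H,M}` are `σ`-related iff `d(H∘σ) ∈ N°`. -/
theorem stmt_16 (n k : ℕ) (hn : 1 ≤ n) (hk : 1 ≤ k) (hkn : k < n)
    (H : (Fin n → ℝ) × (Fin n → ℝ) → ℝ) (hH : ContDiff ℝ (⊤ : ℕ∞) H)
    (ψc : Fin k → Fin n → (Fin n → ℝ) → ℝ) (hψc : ∀ a i, ContDiff ℝ (⊤ : ℕ∞) (ψc a i))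
    (σ : (Fin n → ℝ) → (Fin n → ℝ)) (hσ : ContDiff ℝ (⊤ : ℕ∞) σ)
    (hM : ∀ (a : Fin k) (q : Fin n → ℝ), Psi n k H ψc a (q, σ q) = 0)
    (hcomp : ∀ q : Fin n → ℝ, IsUnit (Cmat n k H ψc (q, σ q)))
    (hdσ : ∀ (q v w : Fin n → ℝ),
      (∀ a, ∑ i, ψc a i q * v i = 0) → (∀ a, ∑ i, ψc a i q * w i = 0) →
      ∑ i, fderiv ℝ σ q v i * w i = ∑ i, fderiv ℝ σ q w i * v i) :
    (∀ q : Fin n → ℝ,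
        fderiv ℝ σ q (fun i => Hp n H i (q, σ q)) = XHMp n k H ψc (q, σ q)) ↔
    (∀ (q v : Fin n → ℝ), (∀ a, ∑ i, ψc a i q * v i = 0) →
        fderiv ℝ (fun q' => H (q', σ q')) q v = 0) := by
  have hHd : Differentiable ℝ H := hH.differentiable (by simp)
  have hH2 : ContDiff ℝ 2 H := contDiff_infty.1 hH 2
  have hψd (a : Fin k) (i : Fin n) : Differentiable ℝ (ψc a i) :=
    (hψc a i).differentiable (by simp)
  have hσd : Differentiable ℝ σ := hσ.differentiable (by simp)
  have hN (q : Fin n → ℝ) (a : Fin k) : ∑ i, ψc a i q * Hp n H i (q, σ q) = 0 := hM a q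
  have hdHσ (q v : Fin n → ℝ) (hv : ∀ a, ∑ i, ψc a i q * v i = 0) :
      fderiv ℝ (fun q' => H (q', σ q')) q v =
        ∑ i, (fderiv ℝ σ q (fun i => Hp n H i (q, σ q)) i + Hq n H i (q, σ q)) * v i := by
    rw [fderiv_comp_graph (hHd _) (hσd q), clm_prod_pi_apply]
    change ∑ i, v i * Hq n H i (q, σ q) + ∑ i, fderiv ℝ σ q v i * Hp n H i (q, σ q) = _
    rw [hdσ q v _ hv (hN q), ← Finset.sum_add_distrib]
    exact Finset.sum_congr rfl fun i _ => by ring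
  refine forall_congr' fun q => ⟨fun h v hv => ?_, fun h => ?_⟩
  · rw [hdHσ q v hv, h]
    have hterm (i : Fin n) : (XHMp n k H ψc (q, σ q) i + Hq n H i (q, σ q)) * v i =
        -∑ a, (∑ b, (Cmat n k H ψc (q, σ q))⁻¹ a b * XHPsi n k H ψc b (q, σ q)) *
          (ψc a i q * v i) := by
      simp only [XHMp, ← Finset.sum_mul, ← mul_assoc]
      ring
    simp only [hterm, Finset.sum_neg_distrib]
    rw [Finset.sum_comm]
    simp [← Finset.mul_sum, hv]
  · obtain ⟨μ, hμ⟩ := exists_eq_sum_of_annihilates (fun a i => ψc a i q)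
      (fun i => fderiv ℝ σ q (fun i => Hp n H i (q, σ q)) i + Hq n H i (q, σ q))
      fun v hv => by rw [← hdHσ q v hv, h v hv]
    set X : Fin n → ℝ := fun i => Hp n H i (q, σ q)
    set C := Cmat n k H ψc (q, σ q) with hC
    have hDσ : fderiv ℝ σ q X =
        (fun i => -Hq n H i (q, σ q)) + ∑ a, μ a • fun i => ψc a i q := by
      ext i
      simp only [Pi.add_apply, Finset.sum_apply, Pi.smul_apply, smul_eq_mul]
      linarith [hμ i]
    have htangent (b : Fin k) : XHPsi n k H ψc b (q, σ q) + ∑ a, μ a * C a b = 0 := by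
      have hz : fderiv ℝ (fun x => Psi n k H ψc b (x, σ x)) q X = 0 := by simp [hM]
      rw [fderiv_comp_graph (differentiable_Psi hH2 hψd b _) (hσd q), hDσ] at hz
      have hsplit : (X, (fun i => -Hq n H i (q, σ q)) + ∑ a, μ a • fun i => ψc a i q) =
          (X, fun i => -Hq n H i (q, σ q)) +
            ∑ a, μ a • ((0 : Fin n → ℝ), fun i => ψc a i q) := by
        ext <;> simp [Prod.fst_sum, Prod.snd_sum]
      rw [hsplit, map_add, map_sum, ← XHPsi_eq_fderiv] at hz
      simpa only [map_smul, smul_eq_mul, fderiv_Psi_vertical hH2 hψd _ b (q, σ q)] using hz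
    have hCμ : C.mulVec μ = -fun b => XHPsi n k H ψc b (q, σ q) := by
      ext b
      have hsum : C.mulVec μ b = ∑ a, μ a * C a b := by
        rw [← Matrix.vecMul_transpose, (Cmat_isSymm hH2 _).eq]
        rfl
      rw [hsum, Pi.neg_apply]
      linarith [htangent b]
    have hμC : μ = -C⁻¹.mulVec fun b => XHPsi n k H ψc b (q, σ q) := by
      rw [← Matrix.mulVec_neg, ← hCμ, Matrix.mulVec_mulVec,
        Matrix.nonsing_inv_mul _ ((Matrix.isUnit_iff_isUnit_det _).1 (hcomp q)),
        Matrix.one_mulVec]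
    rw [hDσ, hμC]
    ext i
    simp [XHMp, Matrix.mulVec, dotProduct, Finset.sum_mul, sub_eq_add_neg, ← hC]
end
end
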